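/- arXiv:2110.12980 — 3 statements merged into one kernel-verified Lean document; each statement's English description precedes it below -/
import Mathlib

section
/- Let z ∈ (0, 1/e) and ε ∈ (0,1), and let w ≤ −1 be a real number satisfying w·e^w = −z (i.e. w = W₋₁(−z)). Then −(1−ε)·log z + √(2(−log z − 1)) + ε − 2/ε < −w < −log z + √(2(−log z − 1)). -/
theorem one_add_add_sq_div_two_lt_exp {t : ℝ} (ht : 0 < t) :
    1 + t + t ^ 2 / 2 < Real.exp t := by
  have h := Real.sum_le_exp_of_nonneg ht.le 4
  simp only [Finset.sum_range_succ, Finset.sum_range_zero, Nat.factorial] at h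
  norm_num at h
  have : 0 < t ^ 3 := by positivity
  linarith

/-- Lambert `W₋₁` estimate: for `z ∈ (0, 1/e)`, `ε ∈ (0,1)`, and `w = W₋₁(-z)`
(characterized as the unique `w ≤ -1` with `w·e^w = -z`), one has
`-(1-ε)·log z + √(2(-log z - 1)) + ε - 2/ε < -w < -log z + √(2(-log z - 1))`. -/
theorem lambertWm1_log_estimate (z ε w : ℝ)
    (hz : z ∈ Set.Ioo (0:ℝ) (Real.exp 1)⁻¹) (hε : ε ∈ Set.Ioo (0:ℝ) 1)
    (hw : w ≤ -1) (hW : w * Real.exp w = -z) :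
    -(1 - ε) * Real.log z + Real.sqrt (2 * (-Real.log z - 1)) + ε - 2 / ε < -w ∧
      -w < -Real.log z + Real.sqrt (2 * (-Real.log z - 1)) := by
  obtain ⟨hz0, hz1⟩ := hz
  obtain ⟨hε0, -⟩ := hε
  have hw1 : w ≠ -1 := by
    rintro rfl
    rw [Real.exp_neg] at hW
    linarith
  have hx : 1 < -w := by
    have := lt_of_le_of_ne hw hw1
    linarith
  have hz_eq : z = -w * Real.exp w := by linarith
  have hlogz : Real.log z = Real.log (-w) + w := by
    rw [hz_eq, Real.log_mul (by linarith) (Real.exp_ne_zero w), Real.log_exp]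
  set t := Real.log (-w) with ht
  have ht0 : 0 < t := Real.log_pos hx
  have hexp : Real.exp t = -w := Real.exp_log (by linarith)
  have hquad : 1 + t + t ^ 2 / 2 < -w := hexp ▸ one_add_add_sq_div_two_lt_exp ht0
  have hu : 0 ≤ 2 * (-Real.log z - 1) := by
    rw [hlogz]
    nlinarith [sq_nonneg t]
  constructor
  · set s := Real.sqrt (2 * (-Real.log z - 1))
    have hs : s ^ 2 = 2 * (-Real.log z - 1) := Real.sq_sqrt hu
    have hamgm : s < ε * (s ^ 2 / 2) + 2 / ε := by
      have h : ε * (s ^ 2 / 2) + 2 / ε - s = ((ε * s - 1) ^ 2 + 3) / (2 * ε) := by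
        field_simp
        ring
      have : 0 < ((ε * s - 1) ^ 2 + 3) / (2 * ε) := by positivity
      linarith
    have hlog : Real.log z = -(s ^ 2 / 2) - 1 := by linarith
    have hw_eq : -w = t + s ^ 2 / 2 + 1 := by linarith
    rw [hlog, hw_eq]
    linarith
  · have : t < Real.sqrt (2 * (-Real.log z - 1)) := by
      apply Real.lt_sqrt_of_sq_lt
      rw [hlogz]
      linarith
    linarith
end

section
/- There exist a constant C > 0 and λ* ∈ (0,λ₀) such that for every λ ∈ (0,λ*): | (α²/4)·λ^α·( β₁' − (2β₁/(2−α))·log λ ) − J(λ)^{−2} | ≤ C·λ^α. -/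
open Set Filter Topology

/-- Derivative of `x ^ (-a) * (b - k * log x) ^ s`. -/
theorem hasDerivAt_rpow_mul_log_rpow (a b k s : ℝ) {x : ℝ} (hx : 0 < x)
    (hg : 0 < b - k * Real.log x) :
    HasDerivAt (fun y : ℝ => y ^ (-a) * (b - k * Real.log y) ^ s)
      (x ^ (-(a + 1)) * (-a * (b - k * Real.log x) ^ s
        - k * s * (b - k * Real.log x) ^ (s - 1))) x := by
  have h1 : HasDerivAt (fun y : ℝ => y ^ (-a)) (-a * x ^ (-a - 1)) x :=
    Real.hasDerivAt_rpow_const (Or.inl hx.ne')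
  have h2 : HasDerivAt (fun y : ℝ => b - k * Real.log y) (-(k * x⁻¹)) x :=
    ((Real.hasDerivAt_log hx.ne').const_mul k).const_sub b
  have h3 := h2.rpow_const (p := s) (Or.inl hg.ne')
  refine (h1.mul h3).congr_deriv ?_
  have e1 : x ^ (-a) = x ^ (-(a + 1)) * x := by
    rw [← Real.rpow_add_one hx.ne']
    ring_nf
  have e2 : -a - 1 = -(a + 1) := by ring
  rw [e2, e1]
  field_simp
  ring

/-- Derivative of `J` in its lower limit of integration. -/
theorem hasDerivAt_integral_rpow_mul_log_rpow (c b k s l₀ : ℝ) {J : ℝ → ℝ}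
    (hg : ∀ μ ∈ Ioc (0:ℝ) l₀, 0 < b - k * Real.log μ)
    (hJ : ∀ l ∈ Ioc (0:ℝ) l₀, J l = ∫ μ in l..l₀, μ ^ c * (b - k * Real.log μ) ^ s)
    {x : ℝ} (hx : x ∈ Ioo 0 l₀) :
    HasDerivAt J (-(x ^ c * (b - k * Real.log x) ^ s)) x := by
  have hcont : ContinuousOn (fun μ : ℝ => μ ^ c * (b - k * Real.log μ) ^ s) (Ioc 0 l₀) := by
    intro y hy
    have hy0 : y ≠ 0 := hy.1.ne'
    refine ContinuousAt.continuousWithinAt ?_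
    exact (Real.continuousAt_rpow_const _ _ (Or.inl hy0)).mul
      ((continuousAt_const.sub (continuousAt_const.mul (Real.continuousAt_log hy0))).rpow_const
        (Or.inl (hg y hy).ne'))
  have hnhds : Ioo 0 l₀ ∈ 𝓝 x := Ioo_mem_nhds hx.1 hx.2
  have hint := (hcont.mono (t := uIcc x l₀) (by
    rw [uIcc_of_le hx.2.le]
    exact fun y hy => ⟨hx.1.trans_le hy.1, hy.2⟩)).intervalIntegrable
      (μ := MeasureTheory.volume)
  have hco := hcont.mono Ioo_subset_Ioc_self
  have h := intervalIntegral.integral_hasDerivAt_left hint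
    (hco.stronglyMeasurableAtFilter isOpen_Ioo x hx) (hco.continuousAt hnhds)
  refine h.congr_of_eventuallyEq ?_
  filter_upwards [hnhds] with y hy using hJ y ⟨hy.1, hy.2.le⟩

/-- `b - k * log l` blows up as `l → 0⁺`. -/
theorem tendsto_sub_mul_log_nhdsGT_zero (b : ℝ) {k : ℝ} (hk : 0 < k) :
    Tendsto (fun l => b - k * Real.log l) (𝓝[>] 0) atTop := by
  simp only [sub_eq_add_neg, ← mul_neg]
  exact tendsto_atTop_add_const_left _ _
    ((tendsto_neg_atBot_atTop.comp Real.tendsto_log_nhdsGT_zero).const_mul_atTop hk)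

/-- `l ^ (-a) * (b - k * log l) ^ (-3/2)` is at least `1` near `0`. -/
theorem eventually_one_le_rpow_mul_log_rpow {a : ℝ} (b k : ℝ) (ha : 0 < a)
    (hg : ∀ᶠ l in 𝓝[>] (0:ℝ), 0 < b - k * Real.log l) :
    ∀ᶠ l in 𝓝[>] (0:ℝ), 1 ≤ l ^ (-a) * (b - k * Real.log l) ^ (-(3:ℝ) / 2) := by
  have hr : 0 < 2 * a / 3 := by positivity
  have h1 : Tendsto (fun l : ℝ => l ^ (2 * a / 3)) (𝓝[>] 0) (𝓝 0) := by
    have := (Real.continuousAt_rpow_const 0 (2 * a / 3) (Or.inr hr.le)).tendsto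
    rw [Real.zero_rpow hr.ne'] at this
    exact this.mono_left nhdsWithin_le_nhds
  have h2 := (h1.const_mul b).sub ((tendsto_log_mul_rpow_nhdsGT_zero hr).const_mul k)
  simp only [mul_zero, sub_zero] at h2
  filter_upwards [h2.eventually (ge_mem_nhds one_pos), hg, self_mem_nhdsWithin] with l hl hgl hl0
  have hl0 : 0 < l := hl0
  have h3 : l ^ (2 * a / 3) * (b - k * Real.log l) ≤ 1 := by linarith
  have hpos : 0 < l ^ (2 * a / 3) := Real.rpow_pos_of_pos hl0 _
  have h4 := Real.one_le_rpow_of_pos_of_le_one_of_nonpos (mul_pos hpos hgl) h3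
    (show -(3:ℝ) / 2 ≤ 0 by norm_num)
  rw [Real.mul_rpow hpos.le hgl.le, ← Real.rpow_mul hl0.le] at h4
  convert h4 using 3
  ring

/-- If `F = g * H / a` with `H ^ 2 * g ^ 3 * P = 1` and `j` is `N * H`-close to `F`, then `j ^ (-2)`
is `O(P)`-close to `F ^ (-2) = a ^ 2 * P * g`. -/
theorem abs_sub_inv_sq_le {a g H P N j : ℝ} (ha : 0 < a) (hg : 0 < g) (hH : 0 < H)
    (hN : 2 * a * N ≤ g) (hP : H ^ 2 * g ^ 3 * P = 1) (hj : |j - g * H / a| ≤ N * H) :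
    |a ^ 2 * P * g - (j ^ 2)⁻¹| ≤ 10 * N * a ^ 3 * P := by
  obtain ⟨F, hF⟩ : ∃ F, F = g * H / a := ⟨_, rfl⟩
  have hF0 : 0 < F := by rw [hF]; positivity
  have hgF : g * H = a * F := by rw [hF]; field_simp
  rw [← hF] at hj
  have hNF : N * H ≤ F / 2 := by
    rw [hF, div_div, le_div_iff₀ (by positivity)]
    nlinarith
  obtain ⟨hj1, hj2⟩ := abs_le.1 hj
  have hjl : F / 2 ≤ j := by linarith
  have hju : j ≤ 3 / 2 * F := by linarith
  have hj0 : 0 < j := by linarith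
  have hNH : 0 ≤ N * H := (abs_nonneg _).trans hj
  have e1 : a ^ 2 * P * g = (F ^ 2)⁻¹ := by
    rw [hF]
    field_simp
    linarith
  have e2 : 10 * N * a ^ 3 * P = 10 * (N * H) / F ^ 3 := by
    rw [hF]
    field_simp
    linear_combination N * hP
  have e3 : (F ^ 2)⁻¹ - (j ^ 2)⁻¹ = (j - F) * ((j + F) / (F ^ 2 * j ^ 2)) := by
    field_simp
    ring
  have h4 : (j + F) / (F ^ 2 * j ^ 2) ≤ 10 / F ^ 3 := by
    rw [div_le_div_iff₀ (by positivity) (by positivity)]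
    have : F ^ 2 / 4 ≤ j ^ 2 := by nlinarith
    have : (j + F) * F ≤ 10 * j ^ 2 := by nlinarith
    nlinarith [mul_le_mul_of_nonneg_left this (sq_nonneg F)]
  rw [e1, e2, e3, abs_mul, abs_of_pos (show 0 < (j + F) / (F ^ 2 * j ^ 2) by positivity)]
  calc |j - F| * ((j + F) / (F ^ 2 * j ^ 2)) ≤ N * H * (10 / F ^ 3) := by gcongr
    _ = _ := by ring

/-- First-order asymptotics of `J` near `0`. -/
theorem exists_eventually_abs_sub_le {a b k l₀ : ℝ} {J : ℝ → ℝ} (ha : 0 < a) (hk : 0 < k)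
    (hl₀ : 0 < l₀) (hg : ∀ μ ∈ Ioc (0:ℝ) l₀, 0 < b - k * Real.log μ)
    (hJ : ∀ l ∈ Ioc (0:ℝ) l₀,
      J l = ∫ μ in l..l₀, μ ^ (-(a + 1)) * (b - k * Real.log μ) ^ (-(1:ℝ) / 2)) :
    ∃ N : ℝ, 0 < N ∧ ∀ᶠ l in 𝓝[>] (0:ℝ),
      |J l - l ^ (-a) * (b - k * Real.log l) ^ (-(1:ℝ) / 2) / a|
        ≤ N * (l ^ (-a) * (b - k * Real.log l) ^ (-(3:ℝ) / 2)) := by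
  have hglim := tendsto_sub_mul_log_nhdsGT_zero b hk
  obtain ⟨m, hm0, hm⟩ := (mem_nhdsGT_iff_exists_Ioc_subset).1
    ((hglim.eventually_ge_atTop (3 * k / a)).and (Ioo_mem_nhdsGT hl₀))
  have hm0 : 0 < m := hm0
  obtain ⟨F, hF⟩ : ∃ F : ℝ → ℝ,
    F = fun l => l ^ (-a) * (b - k * Real.log l) ^ (-(1:ℝ) / 2) := ⟨_, rfl⟩
  obtain ⟨H, hH⟩ : ∃ H : ℝ → ℝ,
    H = fun l => l ^ (-a) * (b - k * Real.log l) ^ (-(3:ℝ) / 2) := ⟨_, rfl⟩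
  have hFd : ∀ x ∈ Ioc 0 m, HasDerivAt (fun l => J l - F l / a)
      (-(x ^ (-(a + 1)) * (k / (2 * a) * (b - k * Real.log x) ^ (-(3:ℝ) / 2)))) x := by
    intro x hx
    have hx' := (hm hx).2
    have h1 := hasDerivAt_integral_rpow_mul_log_rpow _ b k _ l₀ hg hJ hx'
    have h2 := hasDerivAt_rpow_mul_log_rpow a b k (-(1:ℝ) / 2) hx.1 (hg x ⟨hx.1, hx'.2.le⟩)
    rw [hF]
    refine (h1.sub (h2.div_const a)).congr_deriv ?_
    rw [show -(1:ℝ) / 2 - 1 = -(3:ℝ) / 2 by norm_num]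
    field_simp
    ring
  have hHd : ∀ x ∈ Ioc 0 m, HasDerivAt (fun l => J l - F l / a - k / a ^ 2 * H l)
      (x ^ (-(a + 1)) * (k / (2 * a) * (b - k * Real.log x) ^ (-(5:ℝ) / 2)
        * ((b - k * Real.log x) - 3 * k / a))) x := by
    intro x hx
    have hx' := (hm hx).2
    have hgx := hg x ⟨hx.1, hx'.2.le⟩
    have h2 := hasDerivAt_rpow_mul_log_rpow a b k (-(3:ℝ) / 2) hx.1 hgx
    rw [hH]
    refine ((hFd x hx).sub (h2.const_mul (k / a ^ 2))).congr_deriv ?_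
    have e : (b - k * Real.log x) ^ (-(3:ℝ) / 2)
        = (b - k * Real.log x) ^ (-(5:ℝ) / 2) * (b - k * Real.log x) := by
      rw [← Real.rpow_add_one hgx.ne']
      norm_num
    rw [show -(3:ℝ) / 2 - 1 = -(5:ℝ) / 2 by norm_num, e]
    field_simp
    ring
  have hanti : AntitoneOn (fun l => J l - F l / a) (Ioc 0 m) := by
    refine antitoneOn_of_deriv_nonpos (convex_Ioc 0 m)
      (fun x hx => (hFd x hx).continuousAt.continuousWithinAt)
      (fun x hx => (hFd x (interior_subset hx)).differentiableAt.differentiableWithinAt) ?_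
    intro x hx
    have hx := interior_subset hx
    have hgx := hg x ⟨hx.1, (hm hx).2.2.le⟩
    have hx0 : 0 < x := hx.1
    rw [(hFd x hx).deriv]
    exact neg_nonpos.2 (by positivity)
  have hmono : MonotoneOn (fun l => J l - F l / a - k / a ^ 2 * H l) (Ioc 0 m) := by
    refine monotoneOn_of_deriv_nonneg (convex_Ioc 0 m)
      (fun x hx => (hHd x hx).continuousAt.continuousWithinAt)
      (fun x hx => (hHd x (interior_subset hx)).differentiableAt.differentiableWithinAt) ?_
    intro x hx
    have hx := interior_subset hx
    have hgx := hg x ⟨hx.1, (hm hx).2.2.le⟩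
    have hx0 : 0 < x := hx.1
    have h3 : 0 ≤ b - k * Real.log x - 3 * k / a := sub_nonneg.2 (hm hx).1
    rw [(hHd x hx).deriv]
    positivity
  obtain ⟨A, hA⟩ : ∃ A, A = J m - F m / a := ⟨_, rfl⟩
  obtain ⟨B, hB⟩ : ∃ B, B = J m - F m / a - k / a ^ 2 * H m := ⟨_, rfl⟩
  refine ⟨|A| + |B| + k / a ^ 2, by positivity, ?_⟩
  filter_upwards [Ioc_mem_nhdsGT hm0, eventually_one_le_rpow_mul_log_rpow b k ha
    (hglim.eventually_gt_atTop 0)] with l hl h1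
  have hmm : m ∈ Ioc 0 m := ⟨hm0, le_rfl⟩
  have hlow : A ≤ J l - F l / a := hA ▸ hanti hl hmm hl.2
  have hupp : J l - F l / a - k / a ^ 2 * H l ≤ B := hB ▸ hmono hl hmm hl.2
  have hHl : l ^ (-a) * (b - k * Real.log l) ^ (-(3:ℝ) / 2) = H l := by rw [hH]
  have hFl : l ^ (-a) * (b - k * Real.log l) ^ (-(1:ℝ) / 2) = F l := by rw [hF]
  rw [hHl] at h1 ⊢
  rw [hFl]
  have hkH : 0 ≤ k / a ^ 2 * H l := by positivity
  have hAH : |A| ≤ |A| * H l := le_mul_of_one_le_right (abs_nonneg A) h1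
  have hBH : |B| ≤ |B| * H l := le_mul_of_one_le_right (abs_nonneg B) h1
  rw [abs_le, add_mul, add_mul]
  constructor
  · linarith [neg_abs_le A, abs_nonneg B]
  · linarith [le_abs_self B, abs_nonneg A]


/-- Estimate `|(α²/4)·λ^α·(β₁' - (2β₁/(2-α))·log λ) - J(λ)^{-2}| ≤ C·λ^α`
for `λ` small. -/
theorem J_inv_sq_estimate (α β₁ β₁' l₀ : ℝ)
    (hα : α ∈ Set.Ioo (0:ℝ) 2) (hβ₁ : 0 < β₁) (hl₀ : l₀ ∈ Set.Ioo (0:ℝ) 1)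
    (hg : ∀ μ ∈ Set.Ioc (0:ℝ) l₀, 0 < β₁' - 2 * β₁ / (2 - α) * Real.log μ)
    (J : ℝ → ℝ)
    (hJ : ∀ l ∈ Set.Ioc (0:ℝ) l₀,
      J l = ∫ μ in l..l₀,
        μ ^ (-(α / 2 + 1)) * (β₁' - 2 * β₁ / (2 - α) * Real.log μ) ^ (-(1:ℝ) / 2)) :
    ∃ C lstar : ℝ, 0 < C ∧ lstar ∈ Set.Ioo (0:ℝ) l₀ ∧
      ∀ l ∈ Set.Ioo (0:ℝ) lstar,
        |α ^ 2 / 4 * l ^ α * (β₁' - 2 * β₁ / (2 - α) * Real.log l) - ((J l) ^ 2)⁻¹|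
          ≤ C * l ^ α := by
  obtain ⟨hα0, hα2⟩ := hα
  have ha : 0 < α / 2 := by positivity
  have hk : 0 < 2 * β₁ / (2 - α) := div_pos (by positivity) (by linarith)
  generalize 2 * β₁ / (2 - α) = k at *
  obtain ⟨N, hN0, hN⟩ := exists_eventually_abs_sub_le ha hk hl₀.1 hg hJ
  have hglim := tendsto_sub_mul_log_nhdsGT_zero β₁' hk
  obtain ⟨m, hm0, hm⟩ := (mem_nhdsGT_iff_exists_Ioc_subset).1
    ((hN.and (hglim.eventually_ge_atTop (2 * (α / 2) * N))).and (Ioo_mem_nhdsGT hl₀.1))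
  have hm0 : 0 < m := hm0
  refine ⟨10 * N * (α / 2) ^ 3, m, by positivity, (hm ⟨hm0, le_rfl⟩).2, fun l hl => ?_⟩
  obtain ⟨⟨h1, h2⟩, h3⟩ := hm ⟨hl.1, hl.2.le⟩
  have hl0 : 0 < l := hl.1
  have hgl := hg l ⟨hl0, h3.2.le⟩
  generalize β₁' - k * Real.log l = g at *
  have e1 : g ^ (-(1:ℝ) / 2) = g * g ^ (-(3:ℝ) / 2) := by
    rw [mul_comm, ← Real.rpow_add_one hgl.ne']
    norm_num
  have e2 : (g ^ (-(3:ℝ) / 2)) ^ 2 * g ^ 3 = 1 := by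
    rw [← Real.rpow_natCast, ← Real.rpow_natCast, ← Real.rpow_mul hgl.le, ← Real.rpow_add hgl]
    norm_num
  have e3 : (l ^ (-(α / 2))) ^ 2 * l ^ α = 1 := by
    rw [← Real.rpow_natCast, ← Real.rpow_mul hl0.le, ← Real.rpow_add hl0]
    norm_num
  have key := abs_sub_inv_sq_le (a := α / 2) (g := g) (H := l ^ (-(α / 2)) * g ^ (-(3:ℝ) / 2))
    (P := l ^ α) (N := N) (j := J l) ha hgl (by positivity) h2
    (by linear_combination (l ^ (-(α / 2))) ^ 2 * l ^ α * e2 + e3)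
    (by rwa [e1, mul_left_comm] at h1)
  rwa [show (α / 2) ^ 2 = α ^ 2 / 4 by ring] at key
end

section
/- Let λ_app : (s₀,∞) → (0,λ₀) be continuous with J(λ_app(s)) = s for every s > s₀, and define b_app(s) := λ_app(s)^{α/2}·√(β₁' − (2β₁/(2−α))·log λ_app(s)). Then there exist constants c₁, c₂, c₃, c₄, c₅, c₆ > 0 and s* ≥ max(s₀, e) such that for all s ≥ s*: c₁·s^{−2} ≤ λ_app(s)^α·|log λ_app(s)| ≤ c₂·s^{−2}, c₃·s^{−1} ≤ b_app(s) ≤ c₄·s^{−1}, and c₅·s^{−2/α}·(log s)^{−1/α} ≤ λ_app(s) ≤ c₆·s^{−2/α}·(log s)^{−1/α}. -/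
/-- A logarithm of negative slope decays at most like a power: `b - k * log l` is controlled by
`(μ / l) ^ a * (b - k * log μ)` for `l ≤ μ ≤ l₀`. -/
lemma sub_mul_log_le_mul_rpow {a b k l l₀ μ : ℝ} (ha : 0 < a) (hk : 0 < k) (hl : 0 < l)
    (hlμ : l ≤ μ) (hμ : μ ≤ l₀) (hg : 0 < b - k * Real.log l₀) :
    b - k * Real.log l ≤
      (1 + k / (a * (b - k * Real.log l₀))) * (μ / l) ^ a * (b - k * Real.log μ) := by
  have hμ0 : 0 < μ := hl.trans_le hlμ
  have hgμ : b - k * Real.log l₀ ≤ b - k * Real.log μ := by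
    have := Real.log_le_log hμ0 hμ
    gcongr
  set g₀ := b - k * Real.log l₀
  set G := b - k * Real.log μ with hG
  have ht : 1 ≤ μ / l := (one_le_div hl).2 hlμ
  have h1 : 1 ≤ (μ / l) ^ a := Real.one_le_rpow ht ha.le
  have h2 : Real.log (μ / l) ≤ (μ / l) ^ a / a := Real.log_le_rpow_div (by positivity) ha
  rw [Real.log_div hμ0.ne' hl.ne'] at h2
  set P := (μ / l) ^ a
  have h3 : k * (Real.log μ - Real.log l) ≤ k * (P / a) := by gcongr
  have h4 : k * (P / a) ≤ k / (a * g₀) * P * G := by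
    have : k * (P / a) = k / (a * g₀) * P * g₀ := by field_simp
    rw [this]
    gcongr
  have h5 : G ≤ P * G := le_mul_of_one_le_left (hg.le.trans hgμ) h1
  calc b - k * Real.log l = G + k * (Real.log μ - Real.log l) := by rw [hG]; ring
    _ ≤ P * G + k / (a * g₀) * P * G := by linarith
    _ = _ := by ring

lemma integral_rpow_neg_add_one {a l l₀ : ℝ} (ha : 0 < a) (hl : 0 < l) (hll : l ≤ l₀) :
    ∫ μ in l..l₀, μ ^ (-(a + 1)) = (l ^ (-a) - l₀ ^ (-a)) / a := by
  rw [integral_rpow (Or.inr ⟨by linarith, ?_⟩)]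
  · rw [show -(a + 1) + 1 = -a by ring, div_neg, ← neg_div, neg_sub]
  · rw [Set.uIcc_of_le hll]
    exact fun h => absurd h.1 (not_le.2 hl)

lemma intervalIntegrable_rpow_of_pos {r l l₀ : ℝ} (hl : 0 < l) (hll : l ≤ l₀) :
    IntervalIntegrable (fun μ : ℝ => μ ^ r) MeasureTheory.volume l l₀ := by
  refine intervalIntegral.intervalIntegrable_rpow (Or.inr ?_)
  rw [Set.uIcc_of_le hll]
  exact fun h => absurd h.1 (not_le.2 hl)

lemma sub_mul_log_anti {b k x y : ℝ} (hk : 0 < k) (hx : 0 < x) (hxy : x ≤ y) :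
    b - k * Real.log y ≤ b - k * Real.log x := by
  have := Real.log_le_log hx hxy
  gcongr

lemma intervalIntegrable_rpow_mul_sub_log {a b k l l₀ : ℝ} (hk : 0 < k) (hl : 0 < l)
    (hll : l ≤ l₀) (hg : 0 < b - k * Real.log l₀) :
    IntervalIntegrable (fun μ : ℝ => μ ^ (-(a + 1)) * (b - k * Real.log μ) ^ (-(1:ℝ) / 2))
      MeasureTheory.volume l l₀ := by
  apply ContinuousOn.intervalIntegrable
  rw [Set.uIcc_of_le hll]
  intro μ hμ
  have hμ0 : 0 < μ := hl.trans_le hμ.1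
  have hG : 0 < b - k * Real.log μ := hg.trans_le (sub_mul_log_anti hk hμ0 hμ.2)
  apply ContinuousAt.continuousWithinAt
  refine (Real.continuousAt_rpow_const _ _ (Or.inl hμ0.ne')).mul ?_
  exact (continuousAt_const.sub (continuousAt_const.mul
    (Real.continuousAt_log hμ0.ne'))).rpow_const (Or.inl hG.ne')

lemma le_integral_rpow_mul_sub_log {a b k l l₀ : ℝ} (ha : 0 < a) (hk : 0 < k) (hl : 0 < l)
    (hll : l ≤ l₀) (hg : 0 < b - k * Real.log l₀) :
    (l ^ (-a) - l₀ ^ (-a)) / a * (b - k * Real.log l) ^ (-(1:ℝ) / 2) ≤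
      ∫ μ in l..l₀, μ ^ (-(a + 1)) * (b - k * Real.log μ) ^ (-(1:ℝ) / 2) := by
  rw [← integral_rpow_neg_add_one ha hl hll, ← intervalIntegral.integral_mul_const]
  refine intervalIntegral.integral_mono_on hll
    ((intervalIntegrable_rpow_of_pos hl hll).mul_const _)
    (intervalIntegrable_rpow_mul_sub_log hk hl hll hg) fun μ hμ => ?_
  have hμ0 : 0 < μ := hl.trans_le hμ.1
  refine mul_le_mul_of_nonneg_left ?_ (by positivity)
  exact Real.rpow_le_rpow_of_nonpos (hg.trans_le (sub_mul_log_anti hk hμ0 hμ.2))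
    (sub_mul_log_anti hk hl hμ.1) (by norm_num)

lemma integral_rpow_mul_sub_log_le {a b k l l₀ : ℝ} (ha : 0 < a) (hk : 0 < k) (hl : 0 < l)
    (hll : l ≤ l₀) (hg : 0 < b - k * Real.log l₀) :
    ∫ μ in l..l₀, μ ^ (-(a + 1)) * (b - k * Real.log μ) ^ (-(1:ℝ) / 2) ≤
      (1 + k / (a * (b - k * Real.log l₀))) ^ ((1:ℝ) / 2) * (2 / a) *
        (l ^ (-a) * (b - k * Real.log l) ^ (-(1:ℝ) / 2)) := by
  have hgl : 0 < b - k * Real.log l := hg.trans_le (sub_mul_log_anti hk hl hll)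
  set C := 1 + k / (a * (b - k * Real.log l₀)) with hC
  have hC0 : 0 < C := by positivity
  set D := C ^ ((1:ℝ) / 2) * l ^ (-(a / 2)) * (b - k * Real.log l) ^ (-(1:ℝ) / 2) with hD
  have hD0 : 0 < D := by positivity
  have key : ∫ μ in l..l₀, μ ^ (-(a + 1)) * (b - k * Real.log μ) ^ (-(1:ℝ) / 2) ≤
      ∫ μ in l..l₀, μ ^ (-(a / 2 + 1)) * D := by
    refine intervalIntegral.integral_mono_on hll
      (intervalIntegrable_rpow_mul_sub_log hk hl hll hg)
      ((intervalIntegrable_rpow_of_pos hl hll).mul_const _) fun μ hμ => ?_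
    have hμ0 : 0 < μ := hl.trans_le hμ.1
    have hG : 0 < b - k * Real.log μ := hg.trans_le (sub_mul_log_anti hk hμ0 hμ.2)
    have h := Real.rpow_le_rpow_of_nonpos hgl
      (sub_mul_log_le_mul_rpow ha hk hl hμ.1 hμ.2 hg) (z := -(1:ℝ) / 2) (by norm_num)
    rw [← hC, Real.mul_rpow (by positivity) hG.le, Real.mul_rpow hC0.le (by positivity),
      Real.div_rpow hμ0.le hl.le, Real.div_rpow (by positivity) (by positivity),
      ← Real.rpow_mul hμ0.le, ← Real.rpow_mul hl.le] at h
    have e1 : μ ^ (-(a + 1)) = μ ^ (-(a / 2 + 1)) * μ ^ (a * (-(1:ℝ) / 2)) := by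
      rw [← Real.rpow_add hμ0]; congr 1; ring
    have e2 : l ^ (-(a / 2)) = l ^ (a * (-(1:ℝ) / 2)) := by congr 1; ring
    have e3 : C ^ ((1:ℝ) / 2) * C ^ (-(1:ℝ) / 2) = 1 := by
      rw [← Real.rpow_add hC0]; norm_num
    rw [e1, hD, e2, mul_assoc]
    refine mul_le_mul_of_nonneg_left ?_ (by positivity)
    have hp : 0 < l ^ (a * (-(1:ℝ) / 2)) := by positivity
    set p := l ^ (a * (-(1:ℝ) / 2))
    calc μ ^ (a * (-(1:ℝ) / 2)) * (b - k * Real.log μ) ^ (-(1:ℝ) / 2)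
        = (C ^ ((1:ℝ) / 2) * C ^ (-(1:ℝ) / 2)) *
          (μ ^ (a * (-(1:ℝ) / 2)) * (b - k * Real.log μ) ^ (-(1:ℝ) / 2)) := by
          rw [e3, one_mul]
      _ = C ^ ((1:ℝ) / 2) * p * (C ^ (-(1:ℝ) / 2) * (μ ^ (a * (-(1:ℝ) / 2)) / p) *
          (b - k * Real.log μ) ^ (-(1:ℝ) / 2)) := by field_simp
      _ ≤ _ := by gcongr
  refine key.trans ?_
  rw [intervalIntegral.integral_mul_const, integral_rpow_neg_add_one (half_pos ha) hl hll]
  have h0 : 0 ≤ l₀ ^ (-(a / 2)) := Real.rpow_nonneg (hl.le.trans hll) _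
  have e : l ^ (-a) = l ^ (-(a / 2)) * l ^ (-(a / 2)) := by
    rw [← Real.rpow_add hl]; congr 1; ring
  calc (l ^ (-(a / 2)) - l₀ ^ (-(a / 2))) / (a / 2) * D ≤ l ^ (-(a / 2)) / (a / 2) * D := by
        gcongr; linarith
    _ = _ := by rw [e, hD]; field_simp

/-- `b + k * L` is comparable to `L` on `L₀ ≤ L` when it stays above a positive constant there. -/
lemma add_mul_comparable {b k L L₀ g₀ : ℝ} (hL₀ : 0 < L₀) (hL : L₀ ≤ L)
    (hg₀ : 0 < g₀) (hg : g₀ ≤ b + k * L) :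
    k / (1 + |b| / g₀) * L ≤ b + k * L ∧ b + k * L ≤ (|b| / L₀ + k) * L := by
  constructor
  · rw [div_mul_eq_mul_div, div_le_iff₀ (by positivity)]
    have h : |b| ≤ (b + k * L) * (|b| / g₀) := by
      calc |b| = g₀ * (|b| / g₀) := by field_simp
        _ ≤ _ := by gcongr
    linarith [neg_abs_le b]
  · have h : |b| ≤ |b| / L₀ * L := by
      calc |b| = |b| / L₀ * L₀ := by field_simp
        _ ≤ _ := by gcongr
    linarith [le_abs_self b]

/-- If `l ^ α * (-log l)` is of order `s⁻²`, then `-log l` is of order `log s`. -/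
lemma neg_log_comparable_log {α c₁ c₂ L₀ l s : ℝ} (hα : 0 < α) (hc₁ : 0 < c₁) (hc₂ : 0 < c₂)
    (hL₀ : 0 < L₀) (hl : 0 < l) (hL : L₀ ≤ -Real.log l) (hs : Real.exp 1 ≤ s)
    (h₁ : c₁ * s ^ (-2 : ℝ) ≤ l ^ α * -Real.log l)
    (h₂ : l ^ α * -Real.log l ≤ c₂ * s ^ (-2 : ℝ)) :
    Real.log s ≤ (|Real.log (c₂ / L₀)| / L₀ + α) * -Real.log l ∧
      -Real.log l ≤ (2 / α) * (2 + |Real.log (c₁ * (α / 2))|) * Real.log s := by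
  have hs0 : 0 < s := (Real.exp_pos 1).trans_le hs
  have hls : 1 ≤ Real.log s := (Real.le_log_iff_exp_le hs0).2 hs
  constructor
  · have h : l ^ α * L₀ ≤ c₂ * s ^ (-2 : ℝ) := le_trans (by gcongr) h₂
    have h' := Real.log_le_log (by positivity) h
    rw [Real.log_mul (by positivity) hL₀.ne', Real.log_mul hc₂.ne' (by positivity),
      Real.log_rpow hl, Real.log_rpow hs0] at h'
    have h3 : |Real.log (c₂ / L₀)| ≤ |Real.log (c₂ / L₀)| / L₀ * -Real.log l := by
      calc |Real.log (c₂ / L₀)| = |Real.log (c₂ / L₀)| / L₀ * L₀ := by field_simp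
        _ ≤ _ := by gcongr
    have h4 := le_abs_self (Real.log (c₂ / L₀))
    rw [Real.log_div hc₂.ne' hL₀.ne'] at h3 h4
    rw [Real.log_div hc₂.ne' hL₀.ne']
    linarith
  · have h := Real.log_le_rpow_div (inv_pos.2 hl).le (half_pos hα)
    rw [Real.log_inv, Real.inv_rpow hl.le] at h
    have e : l ^ α = l ^ (α / 2) * l ^ (α / 2) := by
      rw [← Real.rpow_add hl]; congr 1; ring
    have h3 : c₁ * (α / 2) * s ^ (-2 : ℝ) ≤ l ^ (α / 2) := by
      calc c₁ * (α / 2) * s ^ (-2 : ℝ) = c₁ * s ^ (-2 : ℝ) * (α / 2) := by ring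
        _ ≤ l ^ α * ((l ^ (α / 2))⁻¹ / (α / 2)) * (α / 2) := by
          refine mul_le_mul_of_nonneg_right (h₁.trans ?_) (by positivity)
          gcongr
        _ = _ := by rw [e]; field_simp
    have h' := Real.log_le_log (by positivity) h3
    rw [Real.log_mul (by positivity) (by positivity), Real.log_rpow hl, Real.log_rpow hs0] at h'
    have h4 : |Real.log (c₁ * (α / 2))| ≤ |Real.log (c₁ * (α / 2))| * Real.log s :=
      le_mul_of_one_le_right (abs_nonneg _) hls
    have h5 := neg_abs_le (Real.log (c₁ * (α / 2)))
    rw [mul_assoc, div_mul_eq_mul_div, le_div_iff₀ hα]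
    linarith

/-- Solving `l ^ α * (-log l) ≈ s⁻²` for `l`, given that `-log l ≈ log s`. -/
lemma rpow_bounds_of_mul_log {α c₁ c₂ A B L l s : ℝ} (hα : 0 < α) (hc₁ : 0 < c₁) (hc₂ : 0 < c₂)
    (hA : 0 < A) (hB : 0 < B) (hl : 0 < l) (hs : 0 < s) (hls : 0 < Real.log s)
    (h₁ : c₁ * s ^ (-2 : ℝ) ≤ l ^ α * L) (h₂ : l ^ α * L ≤ c₂ * s ^ (-2 : ℝ))
    (h₃ : Real.log s ≤ A * L) (h₄ : L ≤ B * Real.log s) :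
    (c₁ / B) ^ (1 / α) * s ^ (-(2 / α)) * Real.log s ^ (-(1 / α)) ≤ l ∧
      l ≤ (c₂ * A) ^ (1 / α) * s ^ (-(2 / α)) * Real.log s ^ (-(1 / α)) := by
  have e : ∀ c : ℝ, 0 < c → c ^ (1 / α) * s ^ (-(2 / α)) * Real.log s ^ (-(1 / α)) =
      (c * s ^ (-2 : ℝ) * (Real.log s)⁻¹) ^ (1 / α) := by
    intro c hc
    rw [Real.mul_rpow (by positivity) (by positivity), Real.mul_rpow hc.le (by positivity),
      ← Real.rpow_mul hs.le, Real.inv_rpow hls.le, Real.rpow_neg hls.le]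
    congr 3
    ring
  have e' : l = (l ^ α) ^ (1 / α) := by
    rw [← Real.rpow_mul hl.le, mul_one_div_cancel hα.ne', Real.rpow_one]
  rw [e _ (by positivity), e _ (by positivity)]
  constructor
  · conv_rhs => rw [e']
    refine Real.rpow_le_rpow (by positivity) ?_ (by positivity)
    rw [← div_eq_mul_inv, div_le_iff₀ hls, div_mul_eq_mul_div, div_le_iff₀ hB]
    calc _ ≤ _ := h₁
      _ ≤ l ^ α * (B * Real.log s) := by gcongr
      _ = _ := by ring
  · conv_lhs => rw [e']
    refine Real.rpow_le_rpow (by positivity) ?_ (by positivity)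
    rw [← div_eq_mul_inv, le_div_iff₀ hls]
    calc _ ≤ l ^ α * (A * L) := by gcongr
      _ = l ^ α * L * A := by ring
      _ ≤ c₂ * s ^ (-2 : ℝ) * A := by gcongr
      _ = _ := by ring


/-- Asymptotics of the approximate blow-up law: `λ_app(s)^α·|log λ_app(s)| ≈ s^{-2}`,
`b_app(s) ≈ s^{-1}`, and `λ_app(s) ≈ s^{-2/α}·(log s)^{-1/α}` for large `s`. -/
theorem lapp_bapp_asymptotics (α β₁ β₁' l₀ s₀ : ℝ)
    (hα : α ∈ Set.Ioo (0:ℝ) 2) (hβ₁ : 0 < β₁) (hl₀ : l₀ ∈ Set.Ioo (0:ℝ) 1)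
    (hg : ∀ μ ∈ Set.Ioc (0:ℝ) l₀, 0 < β₁' - 2 * β₁ / (2 - α) * Real.log μ)
    (J : ℝ → ℝ)
    (hJ : ∀ l ∈ Set.Ioc (0:ℝ) l₀,
      J l = ∫ μ in l..l₀,
        μ ^ (-(α / 2 + 1)) * (β₁' - 2 * β₁ / (2 - α) * Real.log μ) ^ (-(1:ℝ) / 2))
    (lapp bapp : ℝ → ℝ)
    (hlapp_cont : ContinuousOn lapp (Set.Ioi s₀))
    (hlapp_mem : ∀ s, s₀ < s → lapp s ∈ Set.Ioo (0:ℝ) l₀)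
    (hlapp_J : ∀ s, s₀ < s → J (lapp s) = s)
    (hbapp : ∀ s, s₀ < s → bapp s = lapp s ^ (α / 2) *
      Real.sqrt (β₁' - 2 * β₁ / (2 - α) * Real.log (lapp s))) :
    ∃ c₁ c₂ c₃ c₄ c₅ c₆ sstar : ℝ, 0 < c₁ ∧ 0 < c₂ ∧ 0 < c₃ ∧ 0 < c₄ ∧ 0 < c₅ ∧ 0 < c₆ ∧
      max s₀ (Real.exp 1) ≤ sstar ∧
      ∀ s, sstar ≤ s →
        (c₁ * s ^ (-2 : ℝ) ≤ lapp s ^ α * |Real.log (lapp s)| ∧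
          lapp s ^ α * |Real.log (lapp s)| ≤ c₂ * s ^ (-2 : ℝ)) ∧
        (c₃ * s ^ (-1 : ℝ) ≤ bapp s ∧ bapp s ≤ c₄ * s ^ (-1 : ℝ)) ∧
        (c₅ * s ^ (-(2 / α)) * Real.log s ^ (-(1 / α)) ≤ lapp s ∧
          lapp s ≤ c₆ * s ^ (-(2 / α)) * Real.log s ^ (-(1 / α))) := by
  obtain ⟨hα0, hα2⟩ := hα
  obtain ⟨hl₀0, hl₀1⟩ := hl₀
  have hg₀ := hg l₀ ⟨hl₀0, le_rfl⟩
  have hk : 0 < 2 * β₁ / (2 - α) := div_pos (by linarith) (by linarith)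
  set k := 2 * β₁ / (2 - α)
  set g₀ := β₁' - k * Real.log l₀ with hg₀_def
  have ha : 0 < α / 2 := half_pos hα0
  set a := α / 2 with ha_def
  set M := (1 + k / (a * g₀)) ^ ((1:ℝ) / 2) * (2 / a) with hM
  have hM0 : 0 < M := by positivity
  have hL₀ : 0 < -Real.log l₀ := neg_pos.2 (Real.log_neg hl₀0 hl₀1)
  set L₀ := -Real.log l₀
  set m := 1 / (2 * a) with hm
  have hm0 : 0 < m := by positivity
  set p := |β₁'| / L₀ + k with hp
  have hp0 : 0 < p := by positivity
  set q := k / (1 + |β₁'| / g₀) with hq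
  have hq0 : 0 < q := by positivity
  set c₁ := m ^ 2 / p with hc₁
  set c₂ := M ^ 2 / q with hc₂
  have hc₁0 : 0 < c₁ := by positivity
  have hc₂0 : 0 < c₂ := by positivity
  set A := |Real.log (c₂ / L₀)| / L₀ + α
  set B := (2 / α) * (2 + |Real.log (c₁ * (α / 2))|)
  have hA : 0 < A := by positivity
  have hB : 0 < B := by positivity
  set T := M * g₀ ^ (-(1:ℝ) / 2) * (2 * l₀ ^ (-a)) with hT
  refine ⟨c₁, c₂, m, M, (c₁ / B) ^ (1 / α), (c₂ * A) ^ (1 / α), max (max s₀ (Real.exp 1)) T + 1,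
    hc₁0, hc₂0, hm0, hM0, by positivity, by positivity,
    (le_max_left _ _).trans (by linarith), fun s hs => ?_⟩
  have hsM : max (max s₀ (Real.exp 1)) T < s := by linarith
  obtain ⟨⟨hs₀, hse⟩, hsT⟩ : (s₀ < s ∧ Real.exp 1 < s) ∧ T < s := by
    simpa only [max_lt_iff] using hsM
  have hs0 : 0 < s := (Real.exp_pos 1).trans hse
  have hls : 0 < Real.log s := Real.log_pos (by linarith [Real.add_one_le_exp 1])
  obtain ⟨hl, hll⟩ := hlapp_mem s hs₀
  have hJs := hJ (lapp s) ⟨hl, hll.le⟩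
  rw [hlapp_J s hs₀] at hJs
  have hb := hbapp s hs₀
  set l := lapp s
  have hgl : g₀ ≤ β₁' - k * Real.log l := sub_mul_log_anti hk hl hll.le
  have hgl0 := hg₀.trans_le hgl
  have hup := integral_rpow_mul_sub_log_le ha hk hl hll.le hg₀
  have hlow := le_integral_rpow_mul_sub_log ha hk hl hll.le hg₀
  rw [← hJs] at hup hlow
  set G := β₁' - k * Real.log l with hG
  have hw : 0 < G ^ (-(1:ℝ) / 2) := by positivity
  have hFb : l ^ (-a) * G ^ (-(1:ℝ) / 2) * bapp s = 1 := by
    rw [hb, Real.sqrt_eq_rpow, mul_mul_mul_comm, ← Real.rpow_add hl, ← Real.rpow_add hgl0]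
    norm_num
  have hb0 : 0 < bapp s := by rw [hb]; positivity
  have hsmall : 2 * l₀ ^ (-a) ≤ l ^ (-a) := by
    have hGw : G ^ (-(1:ℝ) / 2) ≤ g₀ ^ (-(1:ℝ) / 2) :=
      Real.rpow_le_rpow_of_nonpos hg₀ hgl (by norm_num)
    have h : M * g₀ ^ (-(1:ℝ) / 2) * (2 * l₀ ^ (-a)) ≤ M * g₀ ^ (-(1:ℝ) / 2) * l ^ (-a) := by
      calc M * g₀ ^ (-(1:ℝ) / 2) * (2 * l₀ ^ (-a)) ≤ s := hsT.le
        _ ≤ M * (l ^ (-a) * G ^ (-(1:ℝ) / 2)) := hup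
        _ ≤ M * (l ^ (-a) * g₀ ^ (-(1:ℝ) / 2)) := by gcongr
        _ = _ := by ring
    exact le_of_mul_le_mul_left h (by positivity)
  have hlow' : m * (l ^ (-a) * G ^ (-(1:ℝ) / 2)) ≤ s := by
    refine le_trans ?_ hlow
    rw [← mul_assoc]
    gcongr
    rw [hm, le_div_iff₀ ha]
    field_simp
    linarith
  have hb1 : m ≤ bapp s * s := by
    calc m = m * (l ^ (-a) * G ^ (-(1:ℝ) / 2)) * bapp s := by rw [mul_assoc, hFb, mul_one]
      _ ≤ s * bapp s := by gcongr
      _ = _ := mul_comm _ _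
  have hb2 : bapp s * s ≤ M := by
    calc bapp s * s ≤ bapp s * (M * (l ^ (-a) * G ^ (-(1:ℝ) / 2))) := by gcongr
      _ = M * (l ^ (-a) * G ^ (-(1:ℝ) / 2) * bapp s) := by ring
      _ = M := by rw [hFb, mul_one]
  have hbsq : bapp s ^ 2 = l ^ α * G := by
    rw [hb, mul_pow, Real.sq_sqrt hgl0.le, ← Real.rpow_mul_natCast hl.le]
    congr 2
    rw [ha_def]; push_cast; ring
  have hL : L₀ ≤ -Real.log l := neg_le_neg (Real.log_le_log hl hll.le)
  have hL0 : 0 < -Real.log l := hL₀.trans_le hL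
  have hGL : G = β₁' + k * -Real.log l := by rw [hG]; ring
  obtain ⟨hG1, hG2⟩ := add_mul_comparable hL₀ hL hg₀ (hGL ▸ hgl)
  rw [← hGL] at hG1 hG2
  have es : s ^ (-2 : ℝ) = (s ^ 2)⁻¹ := by
    rw [Real.rpow_neg hs0.le]; norm_num
  have hlα : 0 < l ^ α := by positivity
  have h₁ : c₁ * s ^ (-2 : ℝ) ≤ l ^ α * -Real.log l := by
    rw [es, ← div_eq_mul_inv, div_le_iff₀ (by positivity), hc₁, div_le_iff₀ hp0]
    calc m ^ 2 ≤ (bapp s * s) ^ 2 := by gcongr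
      _ = l ^ α * G * s ^ 2 := by rw [mul_pow, hbsq]
      _ ≤ l ^ α * (p * -Real.log l) * s ^ 2 := by gcongr
      _ = _ := by ring
  have h₂ : l ^ α * -Real.log l ≤ c₂ * s ^ (-2 : ℝ) := by
    rw [es, ← div_eq_mul_inv, le_div_iff₀ (by positivity), hc₂, le_div_iff₀ hq0]
    calc l ^ α * -Real.log l * s ^ 2 * q = l ^ α * (q * -Real.log l) * s ^ 2 := by ring
      _ ≤ l ^ α * G * s ^ 2 := by gcongr
      _ = (bapp s * s) ^ 2 := by rw [mul_pow, hbsq]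
      _ ≤ M ^ 2 := by gcongr
  obtain ⟨h₃, h₄⟩ := neg_log_comparable_log hα0 hc₁0 hc₂0 hL₀ hl hL hse.le h₁ h₂
  rw [abs_of_neg (neg_pos.1 hL0)]
  refine ⟨⟨h₁, h₂⟩, ?_, rpow_bounds_of_mul_log hα0 hc₁0 hc₂0 hA hB hl hs0 hls h₁ h₂ h₃ h₄⟩
  rw [Real.rpow_neg_one, ← div_eq_mul_inv, ← div_eq_mul_inv, div_le_iff₀ hs0, le_div_iff₀ hs0]
  exact ⟨hb1, hb2⟩
end
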